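/- Let ν > 0, m ≥ 1, n ≥ 1 and 0 ≤ θ ≤ ν/2. Let v : ℝ^d → ℝ^d be continuously differentiable with compact support and suppose: (i) the error inequality ν ∫_{Ω_F} |∇v|² dx + νm ∫_{Ω_S} |∇v|² dx + n ∫_{Ω_S} |v|² dx ≤ ∫_{Ω_S} f·v dx + ∫_Σ |g·v| d𝓗^{d−1} + θ ∫_Ω |∇v|² dx holds; (ii) the Poincaré inequality ∫_{Ω_S} |v|² dx ≤ C_P ∫_{Ω_S} |∇v|² dx holds for some C_P ≥ 0; (iii) the interpolation trace inequality ∫_Σ |v|² d𝓗^{d−1} ≤ C_T · (∫_{Ω_S} |∇v|² dx)^{1/2} · (∫_{Ω_S} |v|² dx)^{1/2} holds for some C_T ≥ 0. Then there is a constant C depending only on ν, C_P, C_T, ∫_{Ω_S} |f|² dx and ∫_Σ |g|² d𝓗^{d−1} (but not on m or n) such that (∫_{Ω_F} |∇v|² dx)^{1/2} ≤ C · (νmn)^{-1/4}. (This is the error estimate (mix:5) of Theorem 3, with v playing the role of u_{m,n} − u in the fluid region and θ the absorbed convective contribution under the smallness assumption on f.) -/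

import Mathlib

open MeasureTheory
open scoped RealInnerProductSpace

noncomputable section

/-- `|∇v|²(x) = ∑_{i,j} (∂_j v_i(x))²`. -/
def gradSq {d : ℕ} (v : EuclideanSpace ℝ (Fin d) → EuclideanSpace ℝ (Fin d))
    (x : EuclideanSpace ℝ (Fin d)) : ℝ :=
  ∑ j : Fin d, ‖fderiv ℝ v x (EuclideanSpace.single j 1)‖ ^ 2

/-- Cauchy–Schwarz for the norms of two maps with integrable squared norm; the maps themselves
need not be measurable. -/
theorem integrable_and_integral_norm_mul_norm_le {α E : Type*} [MeasurableSpace α]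
    [NormedAddCommGroup E] {μ : Measure α} {f g : α → E}
    (hf : Integrable (fun x => ‖f x‖ ^ 2) μ) (hg : Integrable (fun x => ‖g x‖ ^ 2) μ) :
    Integrable (fun x => ‖f x‖ * ‖g x‖) μ ∧
      ∫ x, ‖f x‖ * ‖g x‖ ∂μ ≤ √(∫ x, ‖f x‖ ^ 2 ∂μ) * √(∫ x, ‖g x‖ ^ 2 ∂μ) := by
  have memLp_norm {h : α → E} (hh : Integrable (fun x => ‖h x‖ ^ 2) μ) :
      MemLp (fun x => ‖h x‖) 2 μ := by
    have hm : AEStronglyMeasurable (fun x => ‖h x‖) μ := by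
      simpa using Real.continuous_sqrt.comp_aestronglyMeasurable hh.aestronglyMeasurable
    exact (memLp_two_iff_integrable_sq hm).2 hh
  have hf2 := memLp_norm hf
  have hg2 := memLp_norm hg
  refine ⟨hf2.integrable_mul hg2, ?_⟩
  have key := integral_mul_le_Lp_mul_Lq_of_nonneg (μ := μ) Real.HolderConjugate.two_two
    (f := fun x => ‖f x‖) (g := fun x => ‖g x‖)
    (ae_of_all _ fun x => norm_nonneg _) (ae_of_all _ fun x => norm_nonneg _)
    (by simpa using hf2) (by simpa using hg2)
  simpa [Real.sqrt_eq_rpow] using key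

theorem integral_inner_le_sqrt_mul_sqrt {α E : Type*} [MeasurableSpace α]
    [NormedAddCommGroup E] [InnerProductSpace ℝ E] {μ : Measure α} {f g : α → E}
    (hf : Integrable (fun x => ‖f x‖ ^ 2) μ) (hg : Integrable (fun x => ‖g x‖ ^ 2) μ) :
    ∫ x, ⟪f x, g x⟫ ∂μ ≤ √(∫ x, ‖f x‖ ^ 2 ∂μ) * √(∫ x, ‖g x‖ ^ 2 ∂μ) := by
  obtain ⟨hi, hle⟩ := integrable_and_integral_norm_mul_norm_le hf hg
  exact (le_abs_self _).trans ((norm_integral_le_of_norm_le hi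
    (ae_of_all _ fun x => norm_inner_le_norm (𝕜 := ℝ) (f x) (g x))).trans hle)

theorem integral_abs_inner_le_sqrt_mul_sqrt {α E : Type*} [MeasurableSpace α]
    [NormedAddCommGroup E] [InnerProductSpace ℝ E] {μ : Measure α} {f g : α → E}
    (hf : Integrable (fun x => ‖f x‖ ^ 2) μ) (hg : Integrable (fun x => ‖g x‖ ^ 2) μ) :
    ∫ x, |⟪f x, g x⟫| ∂μ ≤ √(∫ x, ‖f x‖ ^ 2 ∂μ) * √(∫ x, ‖g x‖ ^ 2 ∂μ) := by
  obtain ⟨hi, hle⟩ := integrable_and_integral_norm_mul_norm_le hf hg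
  refine (integral_mono_of_nonneg (ae_of_all _ fun x => abs_nonneg _) hi
    (ae_of_all _ fun x => ?_)).trans hle
  exact norm_inner_le_norm (𝕜 := ℝ) (f x) (g x)

theorem gradSq_nonneg {d : ℕ} (v : EuclideanSpace ℝ (Fin d) → EuclideanSpace ℝ (Fin d))
    (x : EuclideanSpace ℝ (Fin d)) : 0 ≤ gradSq v x :=
  Finset.sum_nonneg fun _ _ => sq_nonneg _

theorem integrable_gradSq {d : ℕ} {v : EuclideanSpace ℝ (Fin d) → EuclideanSpace ℝ (Fin d)}
    (hv : ContDiff ℝ 1 v) (hc : HasCompactSupport v) : Integrable (gradSq v) := by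
  have hcont : Continuous (fderiv ℝ v) := hv.continuous_fderiv (by norm_num)
  refine integrable_finsetSum _ fun j _ => Continuous.integrable_of_hasCompactSupport ?_ ?_
  · fun_prop
  · exact (hc.fderiv ℝ).comp_left
      (g := fun L : EuclideanSpace ℝ (Fin d) →L[ℝ] EuclideanSpace ℝ (Fin d) =>
        ‖L (EuclideanSpace.single j 1)‖ ^ 2) (by simp)

/-- The real-variable core of the penalization estimate: absorbing the forcing terms, which are
of order `(B * D) ^ (1 / 4)`, into the two penalization terms. -/
theorem sqrt_le_of_penalization {ν m n θ P T A B D F G S : ℝ}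
    (hν : 0 < ν) (hm : 1 ≤ m) (hn : 1 ≤ n) (hθ : θ ≤ ν / 2)
    (hP : 0 ≤ P) (hT : 0 ≤ T) (hA : 0 ≤ A) (hB : 0 ≤ B) (hD : 0 ≤ D)
    (herr : ν * A + ν * m * B + n * D ≤ √F * √D + √G * √S + θ * (A + B))
    (hDB : D ≤ P * B) (hS : S ≤ T * √B * √D) :
    √A ≤ √((√F * √√P + √G * √T) ^ 2 / (2 * ν)) * (ν * m * n) ^ (-(1 / 4) : ℝ) := by
  set p := √B * √D with hpBD
  set K := √F * √√P + √G * √T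
  have hN : 0 < ν * m * n := by positivity
  set q := √(ν * m * n) with hq
  have hq0 : 0 < q := Real.sqrt_pos.2 hN
  have hp : 0 ≤ p := by positivity
  have hDp : D ≤ √P * p := by
    have h1 : √D ≤ √P * √B := by
      rw [← Real.sqrt_mul hP]
      exact Real.sqrt_le_sqrt hDB
    calc D = √D * √D := (Real.mul_self_sqrt hD).symm
      _ ≤ √P * √B * √D := by gcongr
      _ = √P * p := by ring
  have hsD : √D ≤ √√P * √p := by
    rw [← Real.sqrt_mul (Real.sqrt_nonneg _)]
    exact Real.sqrt_le_sqrt hDp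
  have hsS : √S ≤ √T * √p := by
    rw [← Real.sqrt_mul hT]
    exact Real.sqrt_le_sqrt (by linarith [mul_assoc T √B √D])
  have hforce : √F * √D + √G * √S ≤ K * √p := by
    calc √F * √D + √G * √S ≤ √F * (√√P * √p) + √G * (√T * √p) := by gcongr
      _ = K * √p := by ring
  have habsorb : ν / 2 * A + (ν * m * B / 2 + n * D) ≤ K * √p := by
    have h1 : θ * (A + B) ≤ ν / 2 * (A + B) := by gcongr
    have h2 : ν * B * 1 ≤ ν * B * m := by gcongr
    linarith
  have hqp : q * p ≤ ν * m * B / 2 + n * D := by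
    have hsplit : q * p = √(ν * m * B) * √(n * D) := by
      rw [← Real.sqrt_mul (by positivity), hq, hpBD, ← Real.sqrt_mul hB, ← Real.sqrt_mul hN.le]
      congr 1
      ring
    have e1 := Real.sq_sqrt (show 0 ≤ ν * m * B by positivity)
    have e2 := Real.sq_sqrt (show 0 ≤ n * D by positivity)
    have e3 : 0 ≤ n * D := by positivity
    rw [hsplit]
    linarith [sq_nonneg (√(ν * m * B) - √(n * D)), sub_sq (√(ν * m * B)) √(n * D)]
  have hAq : A ≤ K ^ 2 / (2 * ν) * q⁻¹ := by
    rw [← div_eq_mul_inv, le_div_iff₀ hq0, le_div_iff₀ (by positivity)]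
    have h1 : ν / 2 * A * q ≤ (K * √p - q * p) * q := by
      gcongr
      linarith
    have h2 := Real.sq_sqrt hp
    have h3 : (K * √p - q * p) * q = K * (q * √p) - (q * √p) ^ 2 := by
      rw [mul_pow, h2]
      ring
    linarith [sq_nonneg (K - 2 * (q * √p)), sub_sq K (2 * (q * √p)),
      mul_pow 2 (q * √p) 2]
  have hpow : √(q⁻¹) = (ν * m * n) ^ (-(1 / 4) : ℝ) := by
    rw [hq, Real.sqrt_inv, Real.sqrt_eq_rpow, Real.sqrt_eq_rpow, ← Real.rpow_mul hN.le,
      ← Real.rpow_neg hN.le]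
    norm_num
  rw [← hpow, ← Real.sqrt_mul (by positivity)]
  exact Real.sqrt_le_sqrt hAq

/-- Error estimate (mix:5) of Theorem 3: under the error inequality, the
Poincaré inequality on the obstacle and the interpolation trace inequality,
the `H¹`-seminorm of `v = u_{m,n} − u` on the fluid region is
`O((νmn)^{-1/4})`, with a constant depending only on `ν`, `C_P`, `C_T`,
`∫_{Ω_S} |f|²` and `∫_Σ |g|²` (but not on `m` or `n`). -/
theorem mixed_penalization_fluid_error_estimate
    (d : ℕ) (hd : 1 ≤ d) :
    ∃ C : ℝ → ℝ → ℝ → ℝ → ℝ → ℝ,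
      ∀ (Ω ΩS Sig : Set (EuclideanSpace ℝ (Fin d))),
        IsOpen Ω → Bornology.IsBounded Ω → MeasurableSet ΩS → ΩS ⊆ Ω →
        MeasurableSet Sig → μH[(d : ℝ) - 1] Sig < ⊤ →
      ∀ (f g v : EuclideanSpace ℝ (Fin d) → EuclideanSpace ℝ (Fin d)),
        IntegrableOn (fun x => ‖f x‖ ^ 2) ΩS →
        Integrable (fun x => ‖g x‖ ^ 2) (μH[(d : ℝ) - 1].restrict Sig) →
        ContDiff ℝ 1 v → HasCompactSupport v →
      ∀ (ν m n θ C_P C_T : ℝ),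
        0 < ν → 1 ≤ m → 1 ≤ n → 0 ≤ θ → θ ≤ ν / 2 → 0 ≤ C_P → 0 ≤ C_T →
        (ν * ∫ x in Ω \ ΩS, gradSq v x) + (ν * m * ∫ x in ΩS, gradSq v x)
            + (n * ∫ x in ΩS, ‖v x‖ ^ 2)
          ≤ (∫ x in ΩS, ⟪f x, v x⟫)
            + (∫ x in Sig, |⟪g x, v x⟫| ∂μH[(d : ℝ) - 1])
            + θ * ∫ x in Ω, gradSq v x →
        (∫ x in ΩS, ‖v x‖ ^ 2) ≤ C_P * ∫ x in ΩS, gradSq v x →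
        (∫ x in Sig, ‖v x‖ ^ 2 ∂μH[(d : ℝ) - 1])
          ≤ C_T * Real.sqrt (∫ x in ΩS, gradSq v x)
              * Real.sqrt (∫ x in ΩS, ‖v x‖ ^ 2) →
        Real.sqrt (∫ x in Ω \ ΩS, gradSq v x)
          ≤ C ν C_P C_T (∫ x in ΩS, ‖f x‖ ^ 2)
              (∫ x in Sig, ‖g x‖ ^ 2 ∂μH[(d : ℝ) - 1])
            * (ν * m * n) ^ (-(1/4) : ℝ) := by
  refine ⟨fun ν P T F G => √((√F * √√P + √G * √T) ^ 2 / (2 * ν)), ?_⟩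
  intro Ω ΩS Sig _ _ hΩS hsub _ hfin f g v hf hg hv hc ν m n θ P T hν hm hn _ hθ hP hT
    herr hpoin htrace
  have hcs : HasCompactSupport fun x => ‖v x‖ ^ 2 :=
    hc.comp_left (g := fun y : EuclideanSpace ℝ (Fin d) => ‖y‖ ^ 2) (by simp)
  have hcont : Continuous fun x => ‖v x‖ ^ 2 := by
    have := hv.continuous
    fun_prop
  have hvS : IntegrableOn (fun x => ‖v x‖ ^ 2) ΩS :=
    (hcont.integrable_of_hasCompactSupport hcs).integrableOn
  have hvSig : Integrable (fun x => ‖v x‖ ^ 2) (μH[(d : ℝ) - 1].restrict Sig) := by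
    have : IsFiniteMeasure (μH[(d : ℝ) - 1].restrict Sig) := ⟨by simpa using hfin⟩
    obtain ⟨b, hb⟩ := hcs.exists_bound_of_continuous hcont
    exact Integrable.of_bound hcont.aestronglyMeasurable b (ae_of_all _ hb)
  have hgrad := integrable_gradSq hv hc
  have hsplit : ∫ x in Ω, gradSq v x =
      (∫ x in Ω \ ΩS, gradSq v x) + ∫ x in ΩS, gradSq v x := by
    rw [setIntegral_sdiff hΩS hgrad.integrableOn hsub]
    ring
  refine sqrt_le_of_penalization hν hm hn hθ hP hT
    (integral_nonneg fun x => gradSq_nonneg v x) (integral_nonneg fun x => gradSq_nonneg v x)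
    (integral_nonneg fun x => sq_nonneg _) ?_ hpoin htrace
  rw [hsplit] at herr
  linarith [integral_inner_le_sqrt_mul_sqrt hf hvS, integral_abs_inner_le_sqrt_mul_sqrt hg hvSig]
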